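/- arXiv:2405.18067 — 3 statements merged into one kernel-verified Lean document; each statement's English description precedes it below -/
import Mathlib

section
/- Let K ⊂ ℝ² be a convex polygon with 0 in its interior, facet unit outer normals n_1,…,n_N ∈ ℝ² and oriented heights h_1,…,h_N > 0. Let c(K ×_L J₂K) denote the Haim–Kislev combinatorial quantity for the facet data ñ_i = (n_i,0), ñ_{N+i} = (0, J₂ n_i), h̃_i = h̃_{N+i} = h_i (i = 1,…,N) in (ℝ²×ℝ², ω̃), ω̃((q,p),(q′,p′)) = ⟨q,p′⟩ − ⟨q′,p⟩, namely c = (1/2)·(sup over admissible (β,σ) of Q(β,σ))^{-1}, where admissible means β_i ≥ 0, Σ β̃_i h̃_i = 1, Σ β̃_i ñ_i = 0 and Q(β,σ) = Σ_{1≤j<i≤2N} β_{σ(i)} β_{σ(j)} ω̃(ñ_{σ(j)}, ñ_{σ(i)}) > 0. Then c(K ×_L J₂K) ≤ 2·Vol(K), where Vol(K) is the Euclidean area of K. -/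
open scoped RealInnerProductSpace BigOperators

noncomputable section

/-- `ℝ^m` with the Euclidean inner product. -/
abbrev Es (m : ℕ) := EuclideanSpace ℝ (Fin m)

/-- Doubled facet data: the first copy `f` lives on indices `0,…,N-1`
and the second copy `g` on indices `N,…,2N-1`. -/
def dbl {N : ℕ} {α : Sort _} (f g : Fin N → α) (k : Fin (2 * N)) : α :=
  if hk : (k : ℕ) < N then f ⟨k, hk⟩ else g ⟨(k : ℕ) - N, by omega⟩

/-- The symplectic form on the Lagrangian product `ℝ^{2n} × ℝ^{2n}`:
`ω̃((q,p),(q′,p′)) = ⟪q, p′⟫ − ⟪q′, p⟫`. -/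
def omegaT {m : ℕ} (x y : Es m × Es m) : ℝ := ⟪x.1, y.2⟫ - ⟪y.1, x.2⟫

/-- The Haim–Kislev combinatorial expression for the Ekeland–Hofer–Zehnder capacity of a
convex polytope with facet unit outer normals `m i` and oriented heights `g i` in a
symplectic vector space `(V, ω)`:
`c = (1/2) ⬝ (sup over admissible (β,σ) with Q(β,σ) > 0 of Q(β,σ))⁻¹`, where
`Q(β,σ) = ∑_{j<i} β_{σ(i)} β_{σ(j)} ω(m_{σ(j)}, m_{σ(i)})` and admissibility means
`β i ≥ 0`, `∑ β i * g i = 1`, `∑ β i • m i = 0`. -/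
def combCap {V : Type _} [AddCommGroup V] [Module ℝ V] {L : ℕ}
    (ω : V → V → ℝ) (m : Fin L → V) (g : Fin L → ℝ) : ℝ :=
  (1 / 2 : ℝ) * (sSup {Q : ℝ | ∃ (β : Fin L → ℝ) (σ : Equiv.Perm (Fin L)),
      (∀ i, 0 ≤ β i) ∧ ∑ i, β i * g i = 1 ∧ ∑ i, β i • m i = 0 ∧
      0 < Q ∧ Q = ∑ i, ∑ j ∈ Finset.Iio i, β (σ i) * β (σ j) * ω (m (σ j)) (m (σ i))})⁻¹

open MeasureTheory Set

theorem exists_perm_sum_le_of_isProbabilityMeasure {L : ℕ} (μ : Fin L → Measure ℝ)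
    [∀ k, IsProbabilityMeasure (μ k)] [∀ k, NullSingletonClass (μ k)] (c : Fin L → Fin L → ℝ)
    (hc : ∀ k, c k k = 0) :
    ∃ σ : Equiv.Perm (Fin L),
      ∑ k, ∑ l, c k l * ((μ k).prod (μ l)).real {p | p.2 < p.1} ≤
        ∑ i, ∑ j ∈ Finset.Iio i, c (σ j) (σ i) := by
  have hpair : ∀ k l, k ≠ l → Measure.map (fun s : Fin L → ℝ => (s k, s l)) (Measure.pi μ) =
      (μ k).prod (μ l) := by
    intro k l hkl
    have hind := (ProbabilityTheory.iIndepFun_pi (μ := μ) (X := fun _ x => x)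
      (fun _ => aemeasurable_id)).indepFun hkl
    rw [ProbabilityTheory.indepFun_iff_map_prod_eq_prod_map_map
      (measurable_pi_apply k).aemeasurable (measurable_pi_apply l).aemeasurable,
      (measurePreserving_eval μ k).map_eq, (measurePreserving_eval μ l).map_eq] at hind
    exact hind
  have hmeas : ∀ k l, MeasurableSet {s : Fin L → ℝ | s l < s k} := fun k l =>
    measurableSet_lt (measurable_pi_apply l) (measurable_pi_apply k)
  have hint : ∀ k l, Integrable ({s : Fin L → ℝ | s l < s k}.indicator fun _ => c k l)
      (Measure.pi μ) := fun k l => (integrable_const _).indicator (hmeas k l)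
  have hnull : (Measure.pi μ) (⋃ k, ⋃ l, ⋃ _ : k ≠ l, {s : Fin L → ℝ | s k = s l}) = 0 := by
    simp only [measure_iUnion_null_iff]
    intro k l hkl
    have hd : MeasurableSet {p : ℝ × ℝ | p.1 = p.2} :=
      measurableSet_eq_fun measurable_fst measurable_snd
    have := Measure.map_apply (μ := Measure.pi μ)
      (f := fun s : Fin L → ℝ => (s k, s l)) (by fun_prop) hd
    rw [hpair k l hkl, Measure.prod_apply hd] at this
    refine this.symm.trans ?_
    simp
  obtain ⟨s, hs, hle⟩ := exists_notMem_null_integral_le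
    (f := fun s => ∑ k, ∑ l, ({s : Fin L → ℝ | s l < s k}.indicator (fun _ => c k l)) s)
    (integrable_finsetSum _ fun k _ => integrable_finsetSum _ fun l _ => hint k l) hnull
  have hinj : Function.Injective s := by
    intro k l hkl
    by_contra hne
    exact hs (by simpa using ⟨k, l, hne, hkl⟩)
  refine ⟨Tuple.sort fun k => -s k, ?_⟩
  set σ := Tuple.sort fun k => -s k with hσ
  have hlt : ∀ i j, j < i ↔ s (σ i) < s (σ j) := by
    have hm : StrictMono ((fun k => -s k) ∘ σ) :=
      (Tuple.monotone_sort _).strictMono_of_injective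
        ((neg_injective.comp hinj).comp σ.injective)
    intro i j
    have := hm.lt_iff_lt (a := j) (b := i)
    simpa using this.symm
  have hL : ∑ k, ∑ l, c k l * ((μ k).prod (μ l)).real {p | p.2 < p.1} =
      ∫ s, ∑ k, ∑ l, ({s : Fin L → ℝ | s l < s k}.indicator (fun _ => c k l)) s
        ∂(Measure.pi μ) := by
    rw [integral_finsetSum _ fun k _ => integrable_finsetSum _ fun l _ => hint k l]
    refine Finset.sum_congr rfl fun k _ => ?_
    rw [integral_finsetSum _ fun l _ => hint k l]
    refine Finset.sum_congr rfl fun l _ => ?_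
    rw [integral_indicator_const _ (hmeas k l), smul_eq_mul, mul_comm]
    rcases eq_or_ne k l with rfl | hkl
    · simp [hc]
    · congr 1
      have hd : MeasurableSet {p : ℝ × ℝ | p.2 < p.1} :=
        measurableSet_lt measurable_snd measurable_fst
      rw [← hpair k l hkl, map_measureReal_apply (by fun_prop) hd]
      rfl
  rw [hL]
  refine hle.trans (le_of_eq ?_)
  rw [← Equiv.sum_comp σ]
  simp_rw [← Equiv.sum_comp σ (fun l => ({s : Fin L → ℝ | s l < s _}.indicator _ s))]
  rw [Finset.sum_comm]
  refine Finset.sum_congr rfl fun i _ => ?_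
  simp only [indicator_apply, mem_ofPred_eq, ← hlt]
  rw [← Finset.sum_filter]
  congr 1
  ext j
  simp

theorem exists_perm_sum_le {L : ℕ} (ν : Measure ℝ) [IsFiniteMeasure ν] [NullSingletonClass ν]
    (A : Fin L → Set ℝ) (c : Fin L → Fin L → ℝ)
    (hc : ∀ k, c k k = 0) :
    ∃ σ : Equiv.Perm (Fin L),
      ∑ k, ∑ l, c k l * (ν.prod ν).real ((A k ×ˢ A l) ∩ {p | p.2 < p.1}) ≤
        ∑ i, ∑ j ∈ Finset.Iio i, ν.real (A (σ i)) * ν.real (A (σ j)) * c (σ j) (σ i) := by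
  classical
  let μ : Fin L → Measure ℝ := fun k =>
    if ν (A k) = 0 then volume.restrict (Ioc 0 1) else ProbabilityTheory.cond ν (A k)
  have hp : ∀ k, IsProbabilityMeasure (μ k) := by
    intro k
    by_cases h : ν (A k) = 0
    · simp only [μ, h, if_true]
      exact ⟨by simp⟩
    · simp only [μ, h, if_false]
      exact ProbabilityTheory.cond_isProbabilityMeasure h
  have hn : ∀ k, NullSingletonClass (μ k) := by
    intro k
    by_cases h : ν (A k) = 0
    · simp only [μ, h, if_true]
      infer_instance
    · simp only [μ, h, if_false]
      refine ⟨fun x => ?_⟩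
      exact ProbabilityTheory.cond_absolutelyContinuous (measure_singleton x)
  have hd : MeasurableSet {p : ℝ × ℝ | p.2 < p.1} :=
    measurableSet_lt measurable_snd measurable_fst
  obtain ⟨σ, hσ⟩ := exists_perm_sum_le_of_isProbabilityMeasure μ
    (fun k l => ν.real (A k) * ν.real (A l) * c k l) (fun k => by simp [hc])
  refine ⟨σ, ?_⟩
  convert hσ using 3 with k _ l _
  · rename_i k _ l _
    by_cases hk : ν (A k) = 0
    · have h0 : (ν.prod ν).real ((A k ×ˢ A l) ∩ {p | p.2 < p.1}) = 0 := by
        rw [measureReal_eq_zero_iff]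
        refine measure_mono_null inter_subset_left ?_
        simp [Measure.prod_prod, hk]
      simp [h0, measureReal_def, hk]
    by_cases hl : ν (A l) = 0
    · have h0 : (ν.prod ν).real ((A k ×ˢ A l) ∩ {p | p.2 < p.1}) = 0 := by
        rw [measureReal_eq_zero_iff]
        refine measure_mono_null inter_subset_left ?_
        simp [Measure.prod_prod, hl]
      simp [h0, measureReal_def, hl]
    simp only [μ, hk, hl, if_false, ProbabilityTheory.cond, Measure.prod_smul_left,
      Measure.prod_smul_right, Measure.prod_restrict]
    rw [measureReal_ennreal_smul_apply, measureReal_ennreal_smul_apply,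
      measureReal_restrict_apply hd, inter_comm]
    have hk' : ν.real (A k) ≠ 0 := by
      rwa [Ne, measureReal_eq_zero_iff]
    have hl' : ν.real (A l) ≠ 0 := by
      rwa [Ne, measureReal_eq_zero_iff]
    rw [ENNReal.toReal_inv, ENNReal.toReal_inv, ← measureReal_def, ← measureReal_def]
    field_simp
  · ring

theorem exists_measurable_argmax {α : Type*} [MeasurableSpace α] {N : ℕ} (hN : 0 < N)
    (f : Fin N → α → ℝ) (hf : ∀ i, Measurable (f i)) :
    ∃ ι : α → Fin N, Measurable ι ∧ ∀ t j, f j t ≤ f (ι t) t := by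
  classical
  have hex : ∀ t, ∃ k, ∃ h : k < N, ∀ j, f j t ≤ f ⟨k, h⟩ t := by
    intro t
    have : Nonempty (Fin N) := ⟨⟨0, hN⟩⟩
    obtain ⟨i, hi⟩ := Finite.exists_max fun i => f i t
    exact ⟨i, i.2, hi⟩
  have hm : Measurable fun t => Nat.find (hex t) := by
    refine measurable_find hex fun k => ?_
    by_cases hk : k < N
    · simp only [hk, exists_true_left, ofPred_forall]
      exact MeasurableSet.iInter fun j => measurableSet_le (hf j) (hf _)
    · simp [hk]
  refine ⟨fun t => ⟨Nat.find (hex t), (Nat.find_spec (hex t)).1⟩, ?_,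
    fun t => (Nat.find_spec (hex t)).2⟩
  refine measurable_to_countable' fun i => ?_
  convert hm (measurableSet_singleton (i : ℕ)) using 1
  ext t
  simp [Fin.ext_iff]

theorem countable_setOf_mul_cos_add_mul_sin_eq_zero {a b : ℝ} (h : ¬(a = 0 ∧ b = 0)) :
    {t : ℝ | a * Real.cos t + b * Real.sin t = 0}.Countable := by
  set z : ℂ := ⟨a, b⟩
  have hz : z ≠ 0 := fun h0 => h ⟨congrArg Complex.re h0, congrArg Complex.im h0⟩
  refine (countable_range fun k : ℤ => (2 * k + 1) * Real.pi / 2 + z.arg).mono fun t ht => ?_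
  have ha : a = ‖z‖ * Real.cos z.arg := (Complex.norm_mul_cos_arg z).symm
  have hb : b = ‖z‖ * Real.sin z.arg := (Complex.norm_mul_sin_arg z).symm
  have hc : Real.cos (t - z.arg) = 0 := by
    have : ‖z‖ * Real.cos (t - z.arg) = 0 := by
      rw [Real.cos_sub]
      have ht' : a * Real.cos t + b * Real.sin t = 0 := ht
      rw [ha, hb] at ht'
      linear_combination ht'
    exact (mul_eq_zero.1 this).resolve_left (norm_ne_zero_iff.2 hz)
  obtain ⟨k, hk⟩ := Real.cos_eq_zero_iff.1 hc
  exact ⟨k, by simp only; linarith⟩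

theorem sum_mul_measureReal_preimage {α : Type*} [MeasurableSpace α] {N : ℕ} (ν : Measure α)
    [IsFiniteMeasure ν] {ι : α → Fin N} (hι : Measurable ι) (f : Fin N → ℝ) :
    ∑ i, f i * ν.real (ι ⁻¹' {i}) = ∫ t, f (ι t) ∂ν := by
  have := integral_map (μ := ν) hι.aemeasurable (f := f) (by fun_prop)
  rw [← this, integral_fintype .of_finite]
  refine Finset.sum_congr rfl fun i _ => ?_
  rw [map_measureReal_apply hι (measurableSet_singleton i), smul_eq_mul, mul_comm]

theorem sum_mul_measureReal_prod_inter {α : Type*} [MeasurableSpace α] {N : ℕ}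
    (m : Measure (α × α)) [IsFiniteMeasure m] {ι : α → Fin N} (hι : Measurable ι)
    (c : Fin N → Fin N → ℝ) {D : Set (α × α)} :
    ∑ i, ∑ j, c i j * m.real (((ι ⁻¹' {i}) ×ˢ (ι ⁻¹' {j})) ∩ D) =
      ∫ p in D, c (ι p.1) (ι p.2) ∂m := by
  have hm : Measurable fun p : α × α => (ι p.1, ι p.2) := by fun_prop
  have := integral_map (μ := m.restrict D) hm.aemeasurable
    (f := fun q => c q.1 q.2) (Measurable.of_discrete).aestronglyMeasurable
  rw [← this, integral_fintype .of_finite, Fintype.sum_prod_type]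
  refine Finset.sum_congr rfl fun i _ => Finset.sum_congr rfl fun j _ => ?_
  rw [map_measureReal_apply hm (measurableSet_singleton _),
    measureReal_restrict_apply (hm (measurableSet_singleton _)), smul_eq_mul, mul_comm]
  congr 3
  ext p
  simp

/-- The value at angle `t` of the linear form with coefficients `(a, b)`. -/
def trigForm (a b t : ℝ) : ℝ := a * Real.cos t + b * Real.sin t

section Polar

variable {N : ℕ} {x y : Fin N → ℝ} {ι : ℝ → Fin N}

theorem continuous_trigForm_argmax
    (hmax : ∀ t j, trigForm (x j) (y j) t ≤ trigForm (x (ι t)) (y (ι t)) t) :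
    Continuous fun t => trigForm (x (ι t)) (y (ι t)) t := by
  have hne : (Finset.univ : Finset (Fin N)).Nonempty := ⟨ι 0, Finset.mem_univ _⟩
  have : (fun t => trigForm (x (ι t)) (y (ι t)) t) =
      fun t => Finset.univ.sup' hne fun j => trigForm (x j) (y j) t := by
    ext t
    exact le_antisymm (Finset.le_sup' (fun j => trigForm (x j) (y j) t) (Finset.mem_univ _))
      (Finset.sup'_le _ _ fun j _ => hmax t j)
  rw [this]
  refine Continuous.finset_sup'_apply hne fun j _ => ?_
  unfold trigForm
  fun_prop

/-- Off the countable set of directions where two distinct forms agree, the maximal form is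
locally constant. -/
theorem exists_countable_eventually_argmax
    (hmax : ∀ t j, trigForm (x j) (y j) t ≤ trigForm (x (ι t)) (y (ι t)) t) :
    ∃ B : Set ℝ, B.Countable ∧ ∀ t ∉ B, ∀ᶠ u in nhds t,
      trigForm (x (ι u)) (y (ι u)) u = trigForm (x (ι t)) (y (ι t)) u := by
  refine ⟨⋃ i, ⋃ j, ⋃ _ : ¬(x i - x j = 0 ∧ y i - y j = 0),
    {t | (x i - x j) * Real.cos t + (y i - y j) * Real.sin t = 0}, ?_, ?_⟩
  · exact countable_iUnion fun i => countable_iUnion fun j => countable_iUnion fun h =>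
      countable_setOf_mul_cos_add_mul_sin_eq_zero h
  · intro t ht
    have hev : ∀ j, ∀ᶠ u in nhds t, trigForm (x j) (y j) u ≤ trigForm (x (ι t)) (y (ι t)) u := by
      intro j
      by_cases hj : x (ι t) - x j = 0 ∧ y (ι t) - y j = 0
      · refine Filter.Eventually.of_forall fun u => ?_
        rw [sub_eq_zero.1 hj.1, sub_eq_zero.1 hj.2]
      · have hlt : trigForm (x j) (y j) t < trigForm (x (ι t)) (y (ι t)) t := by
          refine lt_of_le_of_ne (hmax t j) fun he => ht ?_
          simp only [mem_iUnion, mem_ofPred_eq]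
          refine ⟨ι t, j, hj, ?_⟩
          unfold trigForm at he
          linarith
        have hc : ∀ a b, Continuous (trigForm a b) := fun a b => by
          unfold trigForm; fun_prop
        exact ((hc _ _).continuousAt.eventually_lt (hc _ _).continuousAt hlt).mono
          fun u hu => hu.le
    filter_upwards [Filter.eventually_all.2 hev] with u hu
    exact le_antisymm (hu _) (hmax u _)

theorem integral_argmax
    (hι : Measurable ι)
    (hmax : ∀ t j, trigForm (x j) (y j) t ≤ trigForm (x (ι t)) (y (ι t)) t)
    (hpos : ∀ t, 0 < trigForm (x (ι t)) (y (ι t)) t) (a b : ℝ) :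
    (∫ t in a..b, (trigForm (x (ι t)) (y (ι t)) t ^ 2)⁻¹ * x (ι t) =
      Real.sin b / trigForm (x (ι b)) (y (ι b)) b - Real.sin a / trigForm (x (ι a)) (y (ι a)) a) ∧
    (∫ t in a..b, (trigForm (x (ι t)) (y (ι t)) t ^ 2)⁻¹ * y (ι t) =
      Real.cos a / trigForm (x (ι a)) (y (ι a)) a -
        Real.cos b / trigForm (x (ι b)) (y (ι b)) b) := by
  obtain ⟨B, hB, hloc⟩ := exists_countable_eventually_argmax hmax
  have hcont := continuous_trigForm_argmax hmax
  have hint : ∀ f : Fin N → ℝ, IntervalIntegrable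
      (fun t => (trigForm (x (ι t)) (y (ι t)) t ^ 2)⁻¹ * f (ι t)) volume a b := by
    intro f
    refine IntervalIntegrable.continuousOn_mul ?_
      ((hcont.pow 2).inv₀ fun t => (pow_pos (hpos t) 2).ne').continuousOn
    obtain ⟨C, hC⟩ := (Set.finite_range fun i => ‖f i‖).bddAbove
    refine (intervalIntegrable_const (c := C)).mono_fun
      ((Measurable.of_discrete (f := f)).comp hι).aestronglyMeasurable ?_
    exact Filter.Eventually.of_forall fun t =>
      (hC ⟨ι t, rfl⟩).trans (le_abs_self C)
  have hd : ∀ i t, HasDerivAt (trigForm (x i) (y i)) (trigForm (y i) (-x i) t) t := by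
    intro i t
    have := ((Real.hasDerivAt_cos t).const_mul (x i)).add
      ((Real.hasDerivAt_sin t).const_mul (y i))
    exact this.congr_deriv (by unfold trigForm; ring)
  constructor
  · refine integral_eq_of_hasDerivAt_off_countable
      (fun t => Real.sin t / trigForm (x (ι t)) (y (ι t)) t) _ hB
      (Real.continuous_sin.div hcont fun t => (hpos t).ne').continuousOn
      (fun t ht => ?_) (hint x)
    have h1 := (Real.hasDerivAt_sin t).div (hd (ι t) t) (hpos t).ne'
    refine (h1.congr_of_eventuallyEq ((hloc t ht.2).mono fun u hu => ?_)).congr_deriv ?_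
    · simp only [hu, Pi.div_apply]
    · rw [div_eq_inv_mul]
      congr 1
      unfold trigForm
      linear_combination x (ι t) * Real.sin_sq_add_cos_sq t
  · rw [← neg_sub]
    rw [← neg_eq_iff_eq_neg, ← intervalIntegral.integral_neg]
    refine integral_eq_of_hasDerivAt_off_countable
      (fun t => Real.cos t / trigForm (x (ι t)) (y (ι t)) t) _ hB
      (Real.continuous_cos.div hcont fun t => (hpos t).ne').continuousOn
      (fun t ht => ?_) (hint y).neg
    have h1 := (Real.hasDerivAt_cos t).div (hd (ι t) t) (hpos t).ne'
    refine (h1.congr_of_eventuallyEq ((hloc t ht.2).mono fun u hu => ?_)).congr_deriv ?_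
    · simp only [hu, Pi.div_apply]
    · rw [div_eq_inv_mul, ← mul_neg]
      congr 1
      unfold trigForm
      linear_combination -y (ι t) * Real.sin_sq_add_cos_sq t

/-- The measure on directions with density `(g t ^ 2)⁻¹`, twice the area swept by the radial function
`1 / g` of a star-shaped region. -/
def radialMeasure (g : ℝ → ℝ) : Measure ℝ :=
  (volume.restrict (Ioc (-Real.pi) Real.pi)).withDensity fun t => ENNReal.ofReal ((g t ^ 2)⁻¹)

instance (g : ℝ → ℝ) : NullSingletonClass (radialMeasure g) :=
  ⟨fun x => withDensity_absolutelyContinuous _ _ (measure_singleton x)⟩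

theorem isFiniteMeasure_radialMeasure {g : ℝ → ℝ} (hg : Continuous g) (hpos : ∀ t, 0 < g t) :
    IsFiniteMeasure (radialMeasure g) := by
  refine isFiniteMeasure_withDensity_ofReal (Integrable.hasFiniteIntegral ?_)
  exact ((hg.pow 2).inv₀ fun t => (pow_pos (hpos t) 2).ne').integrableOn_Ioc

theorem integral_radialMeasure {g : ℝ → ℝ} (hg : Continuous g) (f : ℝ → ℝ) :
    ∫ t, f t ∂(radialMeasure g) =
      ∫ t in (-Real.pi)..Real.pi, (g t ^ 2)⁻¹ * f t := by
  rw [radialMeasure, integral_withDensity_eq_integral_toReal_smul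
    (by fun_prop) (by simp), intervalIntegral.integral_of_le (by linarith [Real.pi_pos])]
  refine integral_congr_ae (Filter.Eventually.of_forall fun t => ?_)
  simp only [smul_eq_mul]
  rw [ENNReal.toReal_ofReal (by positivity)]

theorem setIntegral_Iio_radialMeasure {g : ℝ → ℝ} (hg : Continuous g) (f : ℝ → ℝ) {s : ℝ}
    (hs : s ∈ Ioc (-Real.pi) Real.pi) :
    ∫ t in Iio s, f t ∂(radialMeasure g) = ∫ t in (-Real.pi)..s, (g t ^ 2)⁻¹ * f t := by
  rw [radialMeasure, restrict_withDensity measurableSet_Iio,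
    integral_withDensity_eq_integral_toReal_smul (by fun_prop) (by simp),
    Measure.restrict_restrict measurableSet_Iio, intervalIntegral.integral_of_le hs.1.le,
    integral_Ioc_eq_integral_Ioo]
  have : Iio s ∩ Ioc (-Real.pi) Real.pi = Ioo (-Real.pi) s := by
    ext t
    simp only [mem_inter_iff, mem_Iio, mem_Ioc, mem_Ioo]
    exact ⟨fun h => ⟨h.2.1, h.1⟩, fun h => ⟨h.2, h.1, h.2.le.trans hs.2⟩⟩
  rw [this]
  refine integral_congr_ae (Filter.Eventually.of_forall fun t => ?_)
  simp only [smul_eq_mul]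
  rw [ENNReal.toReal_ofReal (by positivity)]

theorem ae_radialMeasure_mem_Ioc (g : ℝ → ℝ) :
    ∀ᵐ t ∂(radialMeasure g), t ∈ Ioc (-Real.pi) Real.pi :=
  (withDensity_absolutelyContinuous _ _).ae_le (ae_restrict_mem measurableSet_Ioc)

theorem trigForm_argmax_neg_pi
    (hmax : ∀ t j, trigForm (x j) (y j) t ≤ trigForm (x (ι t)) (y (ι t)) t) :
    trigForm (x (ι (-Real.pi))) (y (ι (-Real.pi))) (-Real.pi) =
      trigForm (x (ι Real.pi)) (y (ι Real.pi)) Real.pi := by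
  have h : ∀ a b, trigForm a b (-Real.pi) = trigForm a b Real.pi := by
    intro a b
    simp [trigForm]
  exact le_antisymm ((h _ _).le.trans (hmax _ _)) ((h _ _).ge.trans (hmax _ _))

theorem integral_radialMeasure_argmax (hι : Measurable ι)
    (hmax : ∀ t j, trigForm (x j) (y j) t ≤ trigForm (x (ι t)) (y (ι t)) t)
    (hpos : ∀ t, 0 < trigForm (x (ι t)) (y (ι t)) t) :
    (∫ t, x (ι t) ∂(radialMeasure fun t => trigForm (x (ι t)) (y (ι t)) t) = 0) ∧
      (∫ t, y (ι t) ∂(radialMeasure fun t => trigForm (x (ι t)) (y (ι t)) t) = 0) := by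
  have hcont := continuous_trigForm_argmax hmax
  obtain ⟨hx, hy⟩ := integral_argmax hι hmax hpos (-Real.pi) Real.pi
  refine ⟨?_, ?_⟩
  · rw [integral_radialMeasure hcont fun t => x (ι t), hx]
    simp
  · rw [integral_radialMeasure hcont fun t => y (ι t), hy, trigForm_argmax_neg_pi hmax]
    simp

/-- The signed area of the boundary curve, as a double integral over ordered pairs of
directions. -/
theorem integral_det_radialMeasure_argmax (hι : Measurable ι)
    (hmax : ∀ t j, trigForm (x j) (y j) t ≤ trigForm (x (ι t)) (y (ι t)) t)
    (hpos : ∀ t, 0 < trigForm (x (ι t)) (y (ι t)) t)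
    {ν : Measure ℝ} [IsFiniteMeasure ν]
    (hν : ν = radialMeasure fun t => trigForm (x (ι t)) (y (ι t)) t) :
    ∫ p in {p : ℝ × ℝ | p.2 < p.1},
      (x (ι p.2) * y (ι p.1) - y (ι p.2) * x (ι p.1)) ∂(ν.prod ν) = ν.real univ := by
  have hcont := continuous_trigForm_argmax hmax
  have hD : MeasurableSet {p : ℝ × ℝ | p.2 < p.1} :=
    measurableSet_lt measurable_snd measurable_fst
  have hintf : ∀ {α : Type} [MeasurableSpace α] (m : Measure α) [IsFiniteMeasure m]
      (f : Fin N × Fin N → ℝ) (k : α → Fin N × Fin N), Measurable k →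
      Integrable (fun p => f (k p)) m := by
    intro α _ m _ f k hk
    obtain ⟨C, hC⟩ := (Set.finite_range fun i => ‖f i‖).bddAbove
    exact Integrable.of_bound ((Measurable.of_discrete (f := f)).comp hk).aestronglyMeasurable C
      (Filter.Eventually.of_forall fun t => hC ⟨k t, rfl⟩)
  have hint1 : ∀ f : Fin N → ℝ, Integrable (fun t => f (ι t)) ν := fun f =>
    hintf ν (fun q => f q.1) (fun t => (ι t, ι t)) (by fun_prop)
  rw [← integral_indicator hD, integral_prod _ ((hintf _
    (fun q => x q.2 * y q.1 - y q.2 * x q.1) (fun p : ℝ × ℝ => (ι p.1, ι p.2))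
    (by fun_prop)).indicator hD)]
  set g := fun t => trigForm (x (ι t)) (y (ι t)) t with hg
  obtain ⟨hX, hY⟩ := integral_radialMeasure_argmax hι hmax hpos
  rw [← hg, ← hν] at hX hY
  have hinner : ∀ᵐ s ∂ν, ∫ t, {p : ℝ × ℝ | p.2 < p.1}.indicator
      (fun p => x (ι p.2) * y (ι p.1) - y (ι p.2) * x (ι p.1)) (s, t) ∂ν =
        1 - Real.sin (-Real.pi) / g (-Real.pi) * y (ι s)
          - Real.cos (-Real.pi) / g (-Real.pi) * x (ι s) := by
    have hae := ae_radialMeasure_mem_Ioc g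
    rw [← hν] at hae
    filter_upwards [hae] with s hs
    have : (fun t => {p : ℝ × ℝ | p.2 < p.1}.indicator
        (fun p => x (ι p.2) * y (ι p.1) - y (ι p.2) * x (ι p.1)) (s, t)) =
        (Iio s).indicator fun t => x (ι t) * y (ι s) - y (ι t) * x (ι s) := by
      ext t
      simp [indicator_apply]
    rw [this, integral_indicator measurableSet_Iio,
      integral_sub ((hint1 x).mul_const _).integrableOn ((hint1 y).mul_const _).integrableOn,
      integral_mul_const, integral_mul_const, hν,
      setIntegral_Iio_radialMeasure hcont (fun t => x (ι t)) hs,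
      setIntegral_Iio_radialMeasure hcont (fun t => y (ι t)) hs]
    obtain ⟨hx, hy⟩ := integral_argmax hι hmax hpos (-Real.pi) s
    rw [hx, hy]
    have h1 : Real.sin s / g s * y (ι s) + Real.cos s / g s * x (ι s) = 1 := by
      have := (hpos s).ne'
      rw [div_mul_eq_mul_div, div_mul_eq_mul_div, ← add_div, div_eq_one_iff_eq this]
      simp only [trigForm]
      ring
    simp only [hg] at h1 ⊢
    linear_combination h1
  have hsub : Integrable (fun s => 1 - Real.sin (-Real.pi) / g (-Real.pi) * y (ι s)) ν :=
    (integrable_const _).sub ((hint1 y).const_mul _)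
  rw [integral_congr_ae hinner, integral_sub hsub ((hint1 x).const_mul _),
    integral_sub (integrable_const _) ((hint1 y).const_mul _),
    integral_const_mul, integral_const_mul, hX, hY]
  simp

theorem radialMeasure_univ {g : ℝ → ℝ} (hpos : ∀ t, 0 < g t)
    {K : Set (ℝ × ℝ)} (hKm : MeasurableSet K)
    (hK : ∀ r t, 0 < r → ((r * Real.cos t, r * Real.sin t) ∈ K ↔ r * g t ≤ 1)) :
    radialMeasure g univ = 2 * volume K := by
  rw [← lintegral_indicator_one hKm, ← lintegral_comp_polarCoord_symm, polarCoord_target,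
    Measure.volume_eq_prod, ← Measure.prod_restrict, lintegral_prod_symm,
    ← lintegral_const_mul' _ _ (by simp), radialMeasure, withDensity_apply _ MeasurableSet.univ,
    Measure.restrict_univ, ← Measure.restrict_congr_set Ioo_ae_eq_Ioc]
  · refine lintegral_congr fun t => ?_
    have hgt := hpos t
    have h1 : ∫⁻ r in Ioi 0, ENNReal.ofReal (r, t).1 • K.indicator 1 (polarCoord.symm (r, t)) =
        ∫⁻ r in Ioc 0 (g t)⁻¹, ENNReal.ofReal r := by
      rw [← lintegral_indicator measurableSet_Ioi, ← lintegral_indicator measurableSet_Ioc]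
      refine lintegral_congr fun r => ?_
      by_cases hr : 0 < r
      · have hiff : (r * Real.cos t, r * Real.sin t) ∈ K ↔ r ≤ (g t)⁻¹ := by
          rw [hK r t hr, ← one_div, le_div_iff₀ hgt]
        by_cases hle : r ≤ (g t)⁻¹
        · simp [hr, hle, hiff.2 hle]
        · simp [hr, hle, mt hiff.1 hle]
      · simp [hr]
    rw [h1, ← ofReal_integral_eq_lintegral_ofReal, ← intervalIntegral.integral_of_le (by positivity),
      integral_id]
    · rw [← ENNReal.ofReal_ofNat, ← ENNReal.ofReal_mul (by norm_num)]
      congr 1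
      rw [inv_pow]
      ring
    · exact continuous_id.integrableOn_Ioc
    · exact (ae_restrict_mem measurableSet_Ioc).mono fun r hr => hr.1.le
  · refine Measurable.aemeasurable ?_
    refine Measurable.smul (ENNReal.measurable_ofReal.comp measurable_fst) ?_
    exact (measurable_one.indicator hKm).comp continuous_polarCoord_symm.measurable

end Polar

theorem sum_fin_two_mul {N : ℕ} {M : Type*} [AddCommMonoid M] (F : Fin (2 * N) → M) :
    ∑ k, F k = ∑ i : Fin N, F ⟨i, by omega⟩ + ∑ i : Fin N, F ⟨N + i, by omega⟩ := by
  rw [← (finCongr (two_mul N).symm).sum_comp, Fin.sum_univ_add]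
  rfl

@[simp]
theorem dbl_left {N : ℕ} {α : Sort*} (f g : Fin N → α) (i : Fin N) (hi : (i : ℕ) < 2 * N) :
    dbl f g ⟨i, hi⟩ = f i := by
  simp [dbl]

@[simp]
theorem dbl_right {N : ℕ} {α : Sort*} (f g : Fin N → α) (i : Fin N) (hi : N + (i : ℕ) < 2 * N) :
    dbl f g ⟨N + i, hi⟩ = g i := by
  simp [dbl]

theorem omegaT_self {m : ℕ} (v : Es m × Es m) : omegaT v v = 0 := sub_self _

/-- A finite measure on parameters whose marked parts balance the vectors `nv / h` and whose
ordered pairs have total determinant equal to the mass `T` yields an admissible pair with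
`Q ≥ 1 / (2 T)`. -/
theorem exists_admissible_of_measure {N : ℕ} (J : Es 2 →ₗ[ℝ] Es 2)
    (hJ : ∀ v : Es 2, J v 0 = -(v 1) ∧ J v 1 = v 0)
    (nv : Fin N → Es 2) (h : Fin N → ℝ) (hpos : ∀ i, 0 < h i)
    (ν : Measure ℝ) [IsFiniteMeasure ν] [NullSingletonClass ν] (hT : 0 < ν.real univ)
    {ι : ℝ → Fin N} (hι : Measurable ι)
    (hX : ∫ t, nv (ι t) 0 / h (ι t) ∂ν = 0) (hY : ∫ t, nv (ι t) 1 / h (ι t) ∂ν = 0)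
    (hdet : ∫ p in {p : ℝ × ℝ | p.2 < p.1}, (nv (ι p.2) 0 / h (ι p.2) * (nv (ι p.1) 1 / h (ι p.1))
      - nv (ι p.2) 1 / h (ι p.2) * (nv (ι p.1) 0 / h (ι p.1))) ∂(ν.prod ν) = ν.real univ) :
    ∃ (β : Fin (2 * N) → ℝ) (σ : Equiv.Perm (Fin (2 * N))), (∀ k, 0 ≤ β k) ∧
      ∑ k, β k * dbl h h k = 1 ∧
      ∑ k, β k • dbl (fun i => (nv i, (0 : Es 2))) (fun i => ((0 : Es 2), J (nv i))) k = 0 ∧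
      1 / (2 * ν.real univ) ≤ ∑ i, ∑ j ∈ Finset.Iio i, β (σ i) * β (σ j) *
        omegaT (dbl (fun i => (nv i, (0 : Es 2))) (fun i => ((0 : Es 2), J (nv i))) (σ j))
          (dbl (fun i => (nv i, (0 : Es 2))) (fun i => ((0 : Es 2), J (nv i))) (σ i)) := by
  set T := ν.real univ
  set m := dbl (fun i => (nv i, (0 : Es 2))) (fun i => ((0 : Es 2), J (nv i))) with hm
  set W : Fin N → ℝ := fun i => ν.real (ι ⁻¹' {i}) with hW
  let A : Fin (2 * N) → Set ℝ := dbl (fun i => ι ⁻¹' {i}) (fun i => ι ⁻¹' {i})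
  let b : Fin N → ℝ := fun i => W i / (2 * T * h i)
  have hβ : ∀ k, dbl b b k = ν.real (A k) / (2 * T * dbl h h k) := by
    intro k
    simp only [dbl, A, b, hW]
    split_ifs <;> rfl
  have hb : ∀ i, 0 ≤ b i := fun i =>
    div_nonneg measureReal_nonneg (mul_pos (by positivity) (hpos i)).le
  have hWT : ∑ i, W i = T := by
    have := sum_mul_measureReal_preimage ν hι fun _ => (1 : ℝ)
    simpa using this
  obtain ⟨σ, hσ⟩ := exists_perm_sum_le ν A
    (fun k l => omegaT (m k) (m l) / (4 * T ^ 2 * dbl h h k * dbl h h l))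
    (fun k => by simp [omegaT_self])
  refine ⟨dbl b b, σ, ?_, ?_, ?_, ?_⟩
  · intro k
    unfold dbl
    split_ifs
    exacts [hb _, hb _]
  · rw [sum_fin_two_mul]
    simp only [dbl_left, dbl_right]
    have : ∀ i, b i * h i = W i / (2 * T) := by
      intro i
      have := (hpos i).ne'
      simp only [b]
      field_simp
    simp only [this, ← Finset.sum_div, hWT]
    field_simp
    norm_num
  · have hbal : ∑ i, b i • nv i = 0 := by
      have hx := sum_mul_measureReal_preimage ν hι fun i => nv i 0 / h i
      have hy := sum_mul_measureReal_preimage ν hι fun i => nv i 1 / h i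
      rw [hX] at hx
      rw [hY] at hy
      have key : ∀ e, (∑ i, nv i e / h i * W i) = 0 → ∑ i, b i * nv i e = 0 := by
        intro e he
        have : ∀ i, b i * nv i e = (nv i e / h i * W i) / (2 * T) := by
          intro i
          have := (hpos i).ne'
          simp only [b]
          field_simp
        simp only [this, ← Finset.sum_div, he, zero_div]
      ext e
      simp only [WithLp.ofLp_sum, Finset.sum_apply, PiLp.smul_apply, smul_eq_mul, PiLp.zero_apply]
      fin_cases e
      exacts [key 0 hx, key 1 hy]
    rw [sum_fin_two_mul]
    simp only [hm, dbl_left, dbl_right]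
    refine Prod.ext ?_ ?_
    · simp [Prod.fst_sum, hbal]
    · have hbalJ : ∑ i, b i • J (nv i) = 0 := by
        simpa only [map_sum, map_smul, map_zero] using congrArg J hbal
      simp [Prod.snd_sum, hbalJ]
  · have hsum := sum_mul_measureReal_prod_inter (ν.prod ν) hι
      (fun i j => nv j 0 / h j * (nv i 1 / h i) - nv j 1 / h j * (nv i 0 / h i))
      (D := {p | p.2 < p.1})
    rw [hdet] at hsum
    have hinner : ∀ i j, ⟪nv i, J (nv j)⟫ = nv j 0 * nv i 1 - nv j 1 * nv i 0 := by
      intro i j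
      simp only [PiLp.inner_apply, Fin.sum_univ_two, hJ, RCLike.inner_apply, conj_trivial]
      ring
    have heq : ∑ k, ∑ l, omegaT (m k) (m l) / (4 * T ^ 2 * dbl h h k * dbl h h l) *
        (ν.prod ν).real ((A k ×ˢ A l) ∩ {p | p.2 < p.1}) = 1 / (2 * T) := by
      simp only [sum_fin_two_mul, hm, A, dbl_left, dbl_right, omegaT, inner_zero_left,
        inner_zero_right, zero_div, zero_mul, add_zero, sub_zero, zero_sub, hinner,
        ← Finset.sum_add_distrib]
      trans (∑ i, ∑ j, (nv j 0 / h j * (nv i 1 / h i) - nv j 1 / h j * (nv i 0 / h i)) *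
        (ν.prod ν).real (((ι ⁻¹' {i}) ×ˢ (ι ⁻¹' {j})) ∩ {p | p.2 < p.1})) / (2 * T ^ 2)
      · simp only [Finset.sum_div]
        refine Finset.sum_congr rfl fun i _ => Finset.sum_congr rfl fun j _ => ?_
        have := (hpos i).ne'
        have := (hpos j).ne'
        field_simp
        ring
      · rw [hsum]
        field_simp
    rw [heq] at hσ
    refine hσ.trans (le_of_eq ?_)
    refine Finset.sum_congr rfl fun i _ => Finset.sum_congr rfl fun j _ => ?_
    rw [hβ, hβ]
    ring

theorem exists_inner_pos_of_isCompact {N : ℕ} {nv : Fin N → Es 2} {h : Fin N → ℝ}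
    (hpos : ∀ i, 0 < h i) (hK : IsCompact {x : Es 2 | ∀ i, ⟪x, nv i⟫ ≤ h i}) {u : Es 2}
    (hu : ‖u‖ = 1) : ∃ i, 0 < ⟪u, nv i⟫ := by
  by_contra! hcon
  obtain ⟨R, hR0, hR⟩ := hK.isBounded.exists_pos_norm_le
  have := hR ((R + 1) • u) fun i => by
    rw [inner_smul_left]
    exact (mul_nonpos_of_nonneg_of_nonpos (by simp; positivity) (hcon i)).trans (hpos i).le
  rw [norm_smul, hu, Real.norm_of_nonneg (by positivity)] at this
  linarith

theorem half_mul_inv_sSup_le {S : Set ℝ} {T Q : ℝ} (hT : 0 < T) (hQS : Q ∈ S)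
    (hQ : 1 / (2 * T) ≤ Q) : 1 / 2 * (sSup S)⁻¹ ≤ T := by
  by_cases hS : BddAbove S
  · have := inv_anti₀ (by positivity) (hQ.trans (le_csSup hS hQS))
    rw [one_div, inv_inv] at this
    linarith
  · rw [Real.sSup_of_not_bddAbove hS]
    simp [hT.le]

theorem combCap_le_of_le_sum {V : Type _} [AddCommGroup V] [Module ℝ V] {L : ℕ}
    {ω : V → V → ℝ} {m : Fin L → V} {g : Fin L → ℝ} {T : ℝ} (hT : 0 < T) (β : Fin L → ℝ)
    (σ : Equiv.Perm (Fin L)) (hβ : ∀ i, 0 ≤ β i) (hg : ∑ i, β i * g i = 1)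
    (hm : ∑ i, β i • m i = 0)
    (hQ : 1 / (2 * T) ≤
      ∑ i, ∑ j ∈ Finset.Iio i, β (σ i) * β (σ j) * ω (m (σ j)) (m (σ i))) :
    combCap ω m g ≤ T :=
  half_mul_inv_sSup_le hT
    ⟨β, σ, hβ, hg, hm, (show (0 : ℝ) < 1 / (2 * T) by positivity).trans_le hQ, rfl⟩ hQ

theorem cap_prod_J2K_le_two_vol (N : ℕ)
    (J : Es 2 →ₗ[ℝ] Es 2)
    (hJ : ∀ x : Es 2, J x 0 = -(x 1) ∧ J x 1 = x 0)
    (nv : Fin N → Es 2) (hunit : ∀ i, ‖nv i‖ = 1)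
    (h : Fin N → ℝ) (hpos : ∀ i, 0 < h i)
    (K : Set (Es 2))
    (hK : K = {x | ∀ i, ⟪x, nv i⟫ ≤ h i})
    (hKcpt : IsCompact K) (h0 : 0 ∈ interior K) :
    combCap omegaT
        (dbl (fun i => (nv i, (0 : Es 2))) (fun i => ((0 : Es 2), J (nv i))))
        (dbl h h)
      ≤ 2 * (MeasureTheory.volume K).toReal := by
  have hinner : ∀ (r t : ℝ) (i : Fin N), ⟪(!₂[r * Real.cos t, r * Real.sin t] : Es 2), nv i⟫ =
      h i * (r * trigForm (nv i 0 / h i) (nv i 1 / h i) t) := by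
    intro r t i
    have := (hpos i).ne'
    simp only [PiLp.inner_apply, Fin.sum_univ_two, RCLike.inner_apply, conj_trivial, trigForm]
    simp
    field_simp
  have hdir : ∀ t, ∃ i, 0 < trigForm (nv i 0 / h i) (nv i 1 / h i) t := by
    intro t
    obtain ⟨i, hi⟩ := exists_inner_pos_of_isCompact hpos (hK ▸ hKcpt)
      (u := !₂[1 * Real.cos t, 1 * Real.sin t]) (by simp [EuclideanSpace.norm_eq])
    rw [hinner, one_mul] at hi
    exact ⟨i, pos_of_mul_pos_right hi (hpos i).le⟩
  have hN : 0 < N := (hdir 0).choose.pos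
  obtain ⟨ι, hι, hmax⟩ := exists_measurable_argmax hN
    (fun i => trigForm (nv i 0 / h i) (nv i 1 / h i)) (fun i => by unfold trigForm; fun_prop)
  have hgpos : ∀ t, 0 < trigForm (nv (ι t) 0 / h (ι t)) (nv (ι t) 1 / h (ι t)) t := fun t =>
    let ⟨i, hi⟩ := hdir t
    hi.trans_le (hmax t i)
  have hcont := continuous_trigForm_argmax (x := fun i => nv i 0 / h i)
    (y := fun i => nv i 1 / h i) hmax
  set ν := radialMeasure fun t => trigForm (nv (ι t) 0 / h (ι t)) (nv (ι t) 1 / h (ι t)) t with hν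
  have hfin : IsFiniteMeasure ν := isFiniteMeasure_radialMeasure hcont hgpos
  let e : Es 2 → ℝ × ℝ := fun v => (v 0, v 1)
  have he : MeasurePreserving e := (volume_preserving_finTwoArrow ℝ).comp
    (EuclideanSpace.volume_preserving_symm_measurableEquiv_toLp (Fin 2))
  let P : Set (ℝ × ℝ) := {p | ∀ i, ⟪(!₂[p.1, p.2] : Es 2), nv i⟫ ≤ h i}
  have hP : MeasurableSet P := by
    have : P = ⋂ i, {p | p.1 * nv i 0 + p.2 * nv i 1 ≤ h i} := by
      ext p
      simp [P, PiLp.inner_apply, Fin.sum_univ_two, mul_comm]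
    rw [this]
    exact MeasurableSet.iInter fun i => measurableSet_le (by fun_prop) measurable_const
  have hKP : K = e ⁻¹' P := by
    rw [hK]
    ext v
    have : !₂[v 0, v 1] = v := by
      ext i
      fin_cases i <;> rfl
    simp [P, e, this]
  have hvol : ν.real univ = 2 * (volume K).toReal := by
    rw [measureReal_def, hKP, he.measure_preimage hP.nullMeasurableSet, hν,
      radialMeasure_univ hgpos hP, ENNReal.toReal_mul, ENNReal.toReal_ofNat]
    intro r t hr
    simp only [P, mem_ofPred_eq, hinner]
    refine ⟨fun H => ?_, fun H i => ?_⟩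
    · exact (mul_le_iff_le_one_right (hpos _)).1 (H (ι t))
    · refine (mul_le_iff_le_one_right (hpos i)).2 (le_trans ?_ H)
      exact mul_le_mul_of_nonneg_left (hmax t i) hr.le
  have hT : 0 < ν.real univ := by
    rw [hvol]
    have : 0 < (volume K).toReal := ENNReal.toReal_pos
      (Measure.measure_pos_of_nonempty_interior _ ⟨0, h0⟩).ne' hKcpt.measure_lt_top.ne
    positivity
  obtain ⟨hX, hY⟩ := integral_radialMeasure_argmax (x := fun i => nv i 0 / h i)
    (y := fun i => nv i 1 / h i) hι hmax hgpos
  obtain ⟨β, σ, hβ, hβh, hβm, hQ⟩ := exists_admissible_of_measure J hJ nv h hpos ν hT hι hX hY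
    (integral_det_radialMeasure_argmax (x := fun i => nv i 0 / h i)
      (y := fun i => nv i 1 / h i) hι hmax hgpos hν)
  rw [← hvol]
  exact combCap_le_of_le_sum hT β σ hβ hβh hβm hQ
end
end

section
/- Let n ≥ 1, let n_1, …, n_N be unit vectors in ℝ^{2n}, and let ((β_i)_{i=1}^N, σ) be a pair with σ a permutation of {1,…,N} and β_i ≥ 0. Define ñ_i = (n_i, 0), ñ_{N+i} = (0, n_i), β̃_i = β̃_{N+i} = β_i/2 for i = 1,…,N, and the permutation σ̃ of {1,…,2N} by σ̃(k) = σ((k+1)/2) if k is odd and σ̃(k) = σ(k/2) + N if k is even. Let ω̃ be the symplectic form on ℝ^{2n} × ℝ^{2n} given by ω̃((q,p),(q′,p′)) = ⟨q, p′⟩ − ⟨q′, p⟩. Then Σ_{1≤j<i≤2N} β̃_{σ̃(i)} β̃_{σ̃(j)} ω̃(ñ_{σ̃(j)}, ñ_{σ̃(i)}) = (1/4) Σ_{i=1}^N β_i². In particular this quantity is strictly positive whenever some β_i > 0. -/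
open scoped RealInnerProductSpace BigOperators

noncomputable section

/-- The interleaving permutation of the indices `0,…,2N-1` (zero-based version of:
`σ̃(k) = σ((k+1)/2)` for odd `k`, `σ̃(k) = σ(k/2) + N` for even `k`, on `{1,…,2N}`). -/
def sigT2 {N : ℕ} (σ : Equiv.Perm (Fin N)) (k : Fin (2 * N)) : Fin (2 * N) :=
  if (k : ℕ) % 2 = 0
  then ⟨(σ ⟨(k : ℕ) / 2, by omega⟩).val, by omega⟩
  else ⟨(σ ⟨(k : ℕ) / 2, by omega⟩).val + N, by omega⟩

theorem Fin.sum_two_mul {M : Type*} [AddCommMonoid M] (N : ℕ) (f : Fin (2 * N) → M) :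
    ∑ k, f k = ∑ a : Fin N,
      (f ⟨2 * (a : ℕ), by omega⟩ + f ⟨2 * (a : ℕ) + 1, by omega⟩) := by
  rw [← (finProdFinEquiv.trans (finCongr (mul_comm N 2))).sum_comp, Fintype.sum_prod_type]
  refine Finset.sum_congr rfl fun a _ => ?_
  rw [Fin.sum_univ_two]
  congr 2 <;> ext <;> simp [finProdFinEquiv, add_comm]

theorem dbl_sigT2_even {N : ℕ} {α : Type*} (f g : Fin N → α) (σ : Equiv.Perm (Fin N))
    (a : Fin N) : dbl f g (sigT2 σ ⟨2 * (a : ℕ), by omega⟩) = f (σ a) := by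
  simp [dbl, sigT2]

theorem dbl_sigT2_odd {N : ℕ} {α : Type*} (f g : Fin N → α) (σ : Equiv.Perm (Fin N))
    (a : Fin N) : dbl f g (sigT2 σ ⟨2 * (a : ℕ) + 1, by omega⟩) = g (σ a) := by
  have h : (2 * (a : ℕ) + 1) / 2 = a := by omega
  simp [dbl, sigT2, h, Nat.add_mod]

theorem doubled_action_KK (n N : ℕ) (hn : 1 ≤ n)
    (nv : Fin N → Es (2 * n)) (hunit : ∀ i, ‖nv i‖ = 1)
    (β : Fin N → ℝ) (hβ : ∀ i, 0 ≤ β i)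
    (σ : Equiv.Perm (Fin N)) :
    (∑ i : Fin (2 * N), ∑ j ∈ Finset.Iio i,
        dbl (fun i => β i / 2) (fun i => β i / 2) (sigT2 σ i) *
          dbl (fun i => β i / 2) (fun i => β i / 2) (sigT2 σ j) *
          omegaT
            (dbl (fun i => (nv i, (0 : Es (2 * n)))) (fun i => ((0 : Es (2 * n)), nv i))
              (sigT2 σ j))
            (dbl (fun i => (nv i, (0 : Es (2 * n)))) (fun i => ((0 : Es (2 * n)), nv i))
              (sigT2 σ i))
      = (1 / 4 : ℝ) * ∑ i, β i ^ 2) ∧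
    ((∃ i, 0 < β i) →
      0 < ∑ i : Fin (2 * N), ∑ j ∈ Finset.Iio i,
        dbl (fun i => β i / 2) (fun i => β i / 2) (sigT2 σ i) *
          dbl (fun i => β i / 2) (fun i => β i / 2) (sigT2 σ j) *
          omegaT
            (dbl (fun i => (nv i, (0 : Es (2 * n)))) (fun i => ((0 : Es (2 * n)), nv i))
              (sigT2 σ j))
            (dbl (fun i => (nv i, (0 : Es (2 * n)))) (fun i => ((0 : Es (2 * n)), nv i))
              (sigT2 σ i))) := by
  rw [and_iff_left_of_imp]
  · simp_rw [← Finset.filter_gt_eq_Iio, Finset.sum_filter]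
    simp only [Fin.sum_two_mul, dbl_sigT2_even, dbl_sigT2_odd, omegaT, inner_zero_left,
      inner_zero_right, sub_zero, zero_sub, neg_zero, mul_zero, ite_self, zero_add, add_zero,
      Fin.mk_lt_mk]
    rw [Finset.mul_sum, ← Equiv.sum_comp σ fun i => 1 / 4 * β i ^ 2]
    refine Finset.sum_congr rfl fun a _ => ?_
    rw [← Finset.sum_add_distrib, Finset.sum_eq_single a]
    · simp [hunit]
      ring
    · intro b _ hba
      have hne : (b : ℕ) ≠ a := Fin.val_ne_of_ne hba
      rcases lt_or_gt_of_ne hne with h | h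
      · rw [if_pos (by omega), if_pos (by omega), real_inner_comm]
        ring
      · rw [if_neg (by omega), if_neg (by omega), add_zero]
    · simp
  · rintro h ⟨i, hi⟩
    rw [h]
    have := Finset.sum_pos' (fun i _ => sq_nonneg (β i)) ⟨i, Finset.mem_univ i, pow_pos hi 2⟩
    positivity
end
end

section
/- Let K ⊂ ℝ^{2n} be a convex polytope with 0 in its interior, facet unit outer normals n_1,…,n_N and oriented heights h_1,…,h_N > 0, and suppose there exists at least one admissible weight vector for K, i.e. (β_i) with β_i ≥ 0, Σ β_i h_i = 1, Σ β_i n_i = 0, not all β_i zero. Let c(K ×_L K) denote the Haim–Kislev combinatorial quantity for the facet data ñ_i = (n_i,0), ñ_{N+i} = (0, n_i), h̃_i = h̃_{N+i} = h_i (i = 1,…,N) in (ℝ^{2n}×ℝ^{2n}, ω̃), ω̃((q,p),(q′,p′)) = ⟨q,p′⟩ − ⟨q′,p⟩, namely c = (1/2)·(sup over admissible (β̃,σ̃) with Q(β̃,σ̃) > 0 of Q(β̃,σ̃))^{-1}, where Q(β̃,σ̃) = Σ_{1≤j<i≤2N} β̃_{σ̃(i)} β̃_{σ̃(j)} ω̃(ñ_{σ̃(j)},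 ñ_{σ̃(i)}). Then c(K ×_L K) ≤ 2 Σ_{i=1}^N h_i². -/
open scoped RealInnerProductSpace BigOperators

noncomputable section

/-- The equivalence enumerating the indices of doubled facet data: `(s, k)` is the `k`-th index
of copy `s`. -/
def dblEquiv (N : ℕ) : Fin 2 × Fin N ≃ Fin (2 * N) := finProdFinEquiv

@[simp] lemma dbl_dblEquiv_zero {N : ℕ} {α : Type*} (f g : Fin N → α) (k : Fin N) :
    dbl f g (dblEquiv N (0, k)) = f k := by
  simp [dbl, dblEquiv]

@[simp] lemma dbl_dblEquiv_one {N : ℕ} {α : Type*} (f g : Fin N → α) (k : Fin N) :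
    dbl f g (dblEquiv N (1, k)) = g k := by
  simp [dbl, dblEquiv]

lemma sum_dblEquiv {N : ℕ} {M : Type*} [AddCommMonoid M] (F : Fin (2 * N) → M) :
    ∑ i, F i = ∑ k, F (dblEquiv N (0, k)) + ∑ k, F (dblEquiv N (1, k)) := by
  rw [← (dblEquiv N).sum_comp, Fintype.sum_prod_type, Fin.sum_univ_two]

/-- The ordering of doubled facet data that alternates between the two copies:
position `s + 2 * k` carries the `k`-th index of copy `s`. -/
def interleave (N : ℕ) : Equiv.Perm (Fin (2 * N)) :=
  (finCongr (mul_comm 2 N)).trans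
    (finProdFinEquiv.symm.trans ((Equiv.prodComm (Fin N) (Fin 2)).trans (dblEquiv N)))

lemma interleave_symm_val {N : ℕ} (s : Fin 2) (k : Fin N) :
    (((interleave N).symm (dblEquiv N (s, k)) : Fin (2 * N)) : ℕ) = s + 2 * k := by
  simp [interleave]

lemma sum_sum_Iio_perm {L : ℕ} {M : Type*} [AddCommMonoid M] (σ : Equiv.Perm (Fin L))
    (F : Fin L → Fin L → M) :
    ∑ i, ∑ j ∈ Finset.Iio i, F (σ i) (σ j) =
      ∑ a, ∑ b, if σ.symm b < σ.symm a then F a b else 0 := by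
  rw [← Equiv.sum_comp σ fun a => ∑ b, if σ.symm b < σ.symm a then F a b else 0]
  refine Finset.sum_congr rfl fun i _ => ?_
  rw [← Equiv.sum_comp σ fun b => if σ.symm b < σ.symm (σ i) then F (σ i) b else 0,
    ← Finset.sum_filter]
  simp only [Equiv.symm_apply_apply]
  exact Finset.sum_congr (by ext; simp) fun _ _ => rfl

/-- For equal weights on the two copies, the interleaved ordering evaluates the
Haim–Kislev quadratic form to the sum of the squared weights. -/
lemma sum_interleave_omegaT {m N : ℕ} (v : Fin N → Es m) (hv : ∀ i, ‖v i‖ = 1)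
    (b : Fin N → ℝ) :
    (∑ i, ∑ j ∈ Finset.Iio i, dbl b b (interleave N i) * dbl b b (interleave N j) *
      omegaT (dbl (fun i => (v i, (0 : Es m))) (fun i => ((0 : Es m), v i)) (interleave N j))
        (dbl (fun i => (v i, (0 : Es m))) (fun i => ((0 : Es m), v i)) (interleave N i))) =
      ∑ k, b k ^ 2 := by
  rw [sum_sum_Iio_perm (interleave N) fun x y => dbl b b x * dbl b b y *
      omegaT (dbl (fun i => (v i, (0 : Es m))) (fun i => ((0 : Es m), v i)) y)
        (dbl (fun i => (v i, (0 : Es m))) (fun i => ((0 : Es m), v i)) x)]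
  simp only [sum_dblEquiv, Fin.lt_def, interleave_symm_val, dbl_dblEquiv_zero,
    dbl_dblEquiv_one, omegaT, inner_zero_left, inner_zero_right]
  simp only [← Finset.sum_add_distrib]
  refine Finset.sum_congr rfl fun k _ => ?_
  rw [Finset.sum_eq_single k]
  · simp [hv, sq]
  · intro l _ hlk
    have hlk' : (l : ℕ) ≠ k := Fin.val_ne_of_ne hlk
    rcases lt_or_gt_of_ne hlk' with hlt | hgt
    · have h₁ : 1 + 2 * (l : ℕ) < 2 * k := by omega
      have h₂ : 2 * (l : ℕ) < 1 + 2 * k := by omega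
      simp [h₁, h₂, real_inner_comm]
    · have h₁ : ¬ 1 + 2 * (l : ℕ) < 2 * k := by omega
      have h₂ : ¬ 2 * (l : ℕ) < 1 + 2 * k := by omega
      simp [h₁, h₂]
  · simp

/-- An admissible pair with value `Q > 0` bounds the combinatorial capacity by `(2 * Q)⁻¹`. -/
lemma combCap_le {V : Type*} [AddCommGroup V] [Module ℝ V] {L : ℕ} (ω : V → V → ℝ)
    (m : Fin L → V) (g : Fin L → ℝ) (β : Fin L → ℝ) (σ : Equiv.Perm (Fin L)) {Q : ℝ}
    (hβ : ∀ i, 0 ≤ β i) (hg : ∑ i, β i * g i = 1) (hm : ∑ i, β i • m i = 0) (hQ : 0 < Q)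
    (hQ' : Q = ∑ i, ∑ j ∈ Finset.Iio i, β (σ i) * β (σ j) * ω (m (σ j)) (m (σ i))) :
    combCap ω m g ≤ (1 / 2 : ℝ) * Q⁻¹ := by
  unfold combCap
  refine mul_le_mul_of_nonneg_left ?_ (by norm_num)
  set S := {Q : ℝ | ∃ (β : Fin L → ℝ) (σ : Equiv.Perm (Fin L)),
      (∀ i, 0 ≤ β i) ∧ ∑ i, β i * g i = 1 ∧ ∑ i, β i • m i = 0 ∧
      0 < Q ∧ Q = ∑ i, ∑ j ∈ Finset.Iio i, β (σ i) * β (σ j) * ω (m (σ j)) (m (σ i))}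
  by_cases hS : BddAbove S
  · exact inv_anti₀ hQ (le_csSup hS ⟨β, σ, hβ, hg, hm, hQ, hQ'⟩)
  · rw [Real.sSup_of_not_bddAbove hS, inv_zero]
    exact (inv_pos.2 hQ).le

theorem cap_prod_KK_le_two_sum_sq (n N : ℕ) (hn : 1 ≤ n)
    (nv : Fin N → Es (2 * n)) (hunit : ∀ i, ‖nv i‖ = 1)
    (h : Fin N → ℝ) (hpos : ∀ i, 0 < h i)
    (K : Set (Es (2 * n)))
    (hK : K = {x | ∀ i, ⟪x, nv i⟫ ≤ h i})
    (hKcpt : IsCompact K) (h0 : 0 ∈ interior K)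
    (hadm : ∃ β : Fin N → ℝ, (∀ i, 0 ≤ β i) ∧ (∃ i, β i ≠ 0) ∧
      ∑ i, β i * h i = 1 ∧ ∑ i, β i • nv i = 0) :
    combCap omegaT
        (dbl (fun i => (nv i, (0 : Es (2 * n)))) (fun i => ((0 : Es (2 * n)), nv i)))
        (dbl h h)
      ≤ 2 * ∑ i, h i ^ 2 := by
  obtain ⟨β, hβ, -, hβh, hβn⟩ := hadm
  set b : Fin N → ℝ := fun i => β i / 2 with hb
  have hbh : ∑ i, b i * h i = 1 / 2 := by
    rw [← hβh, Finset.sum_div]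
    exact Finset.sum_congr rfl fun i _ => by simp only [hb]; ring
  have hbn : ∑ i, b i • nv i = 0 := by
    have : ∑ i, b i • nv i = (1 / 2 : ℝ) • ∑ i, β i • nv i := by
      rw [Finset.smul_sum]
      exact Finset.sum_congr rfl fun i _ => by rw [smul_smul]; congr 1; simp only [hb]; ring
    rw [this, hβn, smul_zero]
  have hcs : (1 / 2 : ℝ) ^ 2 ≤ (∑ i, b i ^ 2) * ∑ i, h i ^ 2 :=
    hbh ▸ Finset.sum_mul_sq_le_sq_mul_sq Finset.univ b h
  have hQ : 0 < ∑ i, b i ^ 2 := by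
    refine lt_of_le_of_ne (Finset.sum_nonneg fun i _ => sq_nonneg _) fun h' => ?_
    rw [← h'] at hcs
    norm_num at hcs
  refine (combCap_le omegaT _ _ (dbl b b) (interleave N) ?_ ?_ ?_ hQ
    (sum_interleave_omegaT nv hunit b).symm).trans ?_
  · intro i
    unfold dbl
    split_ifs <;> exact div_nonneg (hβ _) zero_le_two
  · simp only [sum_dblEquiv, dbl_dblEquiv_zero, dbl_dblEquiv_one, hbh]
    norm_num
  · simp only [sum_dblEquiv, dbl_dblEquiv_zero, dbl_dblEquiv_one]
    ext1 <;> simp [Prod.fst_sum, Prod.snd_sum, hbn]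
  · rw [← div_eq_mul_inv, div_le_iff₀ hQ]
    linarith
end
end
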